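/- Let α > 0 be a real number that is not a natural number expressible as a sum of two integer squares (so the level set {𝒫 = α} contains no lattice point). Then the set {z ∈ ℝ² : 𝒫(z) = α} ∩ Δ is finite and has exactly 4·(2⌊√α⌋ + 1) elements; these are the vertices of the convex polygon {𝒫 = α}. -/

import Mathlib

/-- The piecewise-affine function `P(x) = ⌊x⌋² + (2⌊x⌋+1)(x − ⌊x⌋)`. -/
noncomputable def Pfun (x : ℝ) : ℝ := (⌊x⌋ : ℝ)^2 + (2*(⌊x⌋ : ℝ)+1)*(x - ⌊x⌋)

/-- The piecewise-affine Hamiltonian `𝒫(x,y) = P(x) + P(y)`. -/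
noncomputable def ham (z : ℝ × ℝ) : ℝ := Pfun z.1 + Pfun z.2

/-- The set `Δ` of horizontal and vertical lines through lattice points. -/
def Delta : Set (ℝ × ℝ) := {q | (q.1 - ⌊q.1⌋) * (q.2 - ⌊q.2⌋) = 0}

lemma Pfun_eq (x : ℝ) (n : ℤ) (h1 : (n : ℝ) ≤ x) (h2 : x ≤ n + 1) :
    Pfun x = (n : ℝ)^2 + (2 * n + 1) * (x - n) := by
  unfold Pfun
  rcases h2.lt_or_eq with h2 | h2
  · rw [Int.floor_eq_iff.2 ⟨h1, h2⟩]
  · have : ⌊x⌋ = n + 1 := by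
      rw [Int.floor_eq_iff]; push_cast; constructor <;> linarith
    rw [this]; push_cast; rw [h2]; ring

lemma Pfun_int (n : ℤ) : Pfun n = (n : ℝ)^2 := by
  simp [Pfun]

lemma Pfun_neg (x : ℝ) : Pfun (-x) = Pfun x := by
  have h1 := Int.floor_le x
  have h2 := (Int.lt_floor_add_one x).le
  rw [Pfun_eq x ⌊x⌋ h1 h2, Pfun_eq (-x) (-⌊x⌋ - 1) (by push_cast; linarith)
    (by push_cast; linarith)]
  push_cast; ring

lemma Pfun_abs (x : ℝ) : Pfun |x| = Pfun x := by
  rcases abs_choice x with h | h <;> rw [h]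
  exact Pfun_neg x

lemma Pfun_nonneg (x : ℝ) : 0 ≤ Pfun x := by
  rw [← Pfun_abs]
  unfold Pfun
  have h1 := Int.floor_le |x|
  have h3 : (0 : ℝ) ≤ ⌊|x|⌋ := by exact_mod_cast Int.floor_nonneg.2 (abs_nonneg x)
  have := mul_nonneg (by linarith : (0 : ℝ) ≤ 2 * ⌊|x|⌋ + 1) (sub_nonneg.2 h1)
  positivity

noncomputable def Pinv (b : ℝ) : ℝ := ⌊√b⌋ + (b - (⌊√b⌋ : ℝ)^2) / (2 * ⌊√b⌋ + 1)

lemma Pinv_spec (b : ℝ) (hb : 0 < b) : 0 < Pinv b ∧ Pfun (Pinv b) = b := by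
  have hs : 0 < √b := Real.sqrt_pos.2 hb
  have hq : √b ^ 2 = b := Real.sq_sqrt hb.le
  unfold Pinv
  have h0 : (0 : ℝ) ≤ ⌊√b⌋ := by exact_mod_cast Int.floor_nonneg.2 hs.le
  have h1 := Int.floor_le √b
  have h2 := Int.lt_floor_add_one √b
  generalize ⌊√b⌋ = n at *
  have hd : (0 : ℝ) < 2 * n + 1 := by linarith
  have a1 : 0 ≤ (b - (n : ℝ)^2) / (2 * n + 1) := div_nonneg (by nlinarith) hd.le
  have a2 : (b - (n : ℝ)^2) / (2 * n + 1) ≤ 1 := by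
    rw [div_le_one hd]; nlinarith
  constructor
  · rcases h0.lt_or_eq with h | h
    · linarith
    · rw [← h]; simpa using hb
  · rw [Pfun_eq _ n (by linarith) (by linarith)]
    field_simp
    ring

lemma Pinv_left (y : ℝ) (hy : 0 ≤ y) : Pinv (Pfun y) = y := by
  have h0 : (0 : ℝ) ≤ ⌊y⌋ := by exact_mod_cast Int.floor_nonneg.2 hy
  have h1 := Int.floor_le y
  have h2 := Int.lt_floor_add_one y
  have hf : ⌊√(Pfun y)⌋ = ⌊y⌋ := by
    rw [Int.floor_eq_iff]
    constructor
    · apply Real.le_sqrt_of_sq_le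
      unfold Pfun; nlinarith
    · rw [Real.sqrt_lt' (by linarith)]
      unfold Pfun; nlinarith
  unfold Pinv
  rw [hf]
  unfold Pfun
  have : (2 * (⌊y⌋ : ℝ) + 1) ≠ 0 := by linarith
  field_simp
  ring

lemma floor_sqrt_mem (α : ℝ) (hα : 0 < α) (m : ℤ) :
    m ∈ Finset.Icc (-⌊√α⌋) ⌊√α⌋ ↔ (m : ℝ)^2 ≤ α := by
  rw [Finset.mem_Icc, ← abs_le, Int.le_floor, Int.cast_abs,
    Real.le_sqrt (abs_nonneg _) hα.le, sq_abs]

noncomputable def vmap (α : ℝ) (p : ℤ × ℤ) : ℝ × ℝ := (p.1, p.2 * Pinv (α - (p.1 : ℝ)^2))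

noncomputable def vset (α : ℝ) : Finset (ℝ × ℝ) :=
  (Finset.Icc (-⌊√α⌋) ⌊√α⌋ ×ˢ ({1, -1} : Finset ℤ)).image (vmap α)

lemma mem_vset (α : ℝ) (hα : 0 < α) (h : ¬ ∃ a b : ℤ, α = (a : ℝ)^2 + (b : ℝ)^2) (z : ℝ × ℝ) :
    z ∈ vset α ↔ ham z = α ∧ ∃ m : ℤ, z.1 = m := by
  have hlt : ∀ m : ℤ, (m : ℝ)^2 ≤ α → 0 < α - (m : ℝ)^2 := fun m hm =>
    sub_pos.2 (lt_of_le_of_ne hm fun e => h ⟨m, 0, by simp [e]⟩)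
  unfold vset
  rw [Finset.mem_image]
  constructor
  · rintro ⟨⟨m, s⟩, hp, rfl⟩
    rw [Finset.mem_product, floor_sqrt_mem α hα] at hp
    obtain ⟨hm, hs⟩ := hp
    have hspec := (Pinv_spec _ (hlt m hm)).2
    refine ⟨?_, m, rfl⟩
    simp only [Finset.mem_insert, Finset.mem_singleton] at hs
    simp only [ham, vmap, Pfun_int]
    rcases hs with rfl | rfl
    · simp [hspec]
    · simp [Pfun_neg, hspec]
  · rintro ⟨hz, m, hm⟩
    obtain ⟨x, y⟩ := z
    simp only at hm
    subst hm
    simp only [ham, Pfun_int] at hz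
    have hy : α - (m : ℝ)^2 = Pfun |y| := by rw [Pfun_abs]; linarith
    have hm : (m : ℝ)^2 ≤ α := by linarith [Pfun_nonneg y]
    have hi : Pinv (α - (m : ℝ)^2) = |y| := by rw [hy, Pinv_left _ (abs_nonneg y)]
    rcases abs_choice y with e | e
    · refine ⟨(m, 1), ?_, ?_⟩
      · rw [Finset.mem_product, floor_sqrt_mem α hα]; exact ⟨hm, by simp⟩
      · simp [vmap, hi, e]
    · refine ⟨(m, -1), ?_, ?_⟩
      · rw [Finset.mem_product, floor_sqrt_mem α hα]; exact ⟨hm, by simp⟩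
      · simp [vmap, hi, e]

lemma card_vset (α : ℝ) (hα : 0 < α) (h : ¬ ∃ a b : ℤ, α = (a : ℝ)^2 + (b : ℝ)^2) :
    (vset α).card = (2 * (⌊√α⌋).toNat + 1) * 2 := by
  have hlt : ∀ m : ℤ, (m : ℝ)^2 ≤ α → 0 < α - (m : ℝ)^2 := fun m hm =>
    sub_pos.2 (lt_of_le_of_ne hm fun e => h ⟨m, 0, by simp [e]⟩)
  unfold vset
  rw [Finset.card_image_of_injOn, Finset.card_product, Int.card_Icc]
  · have : 0 ≤ ⌊√α⌋ := Int.floor_nonneg.2 (Real.sqrt_nonneg _)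
    have h2 : ({1, -1} : Finset ℤ).card = 2 := by decide
    rw [h2]
    omega
  · rintro ⟨m, s⟩ hp ⟨m', s'⟩ - he
    rw [Finset.mem_coe, Finset.mem_product, floor_sqrt_mem α hα] at hp
    have hpos := (Pinv_spec _ (hlt m hp.1)).1
    simp only [vmap, Prod.mk.injEq, Int.cast_inj] at he
    obtain ⟨rfl, he⟩ := he
    have := mul_right_cancel₀ hpos.ne' he
    rw [Int.cast_inj] at this
    rw [this]

theorem vertex_count (α : ℝ) (hα : 0 < α)
    (h : ¬ ∃ a b : ℤ, α = (a : ℝ)^2 + (b : ℝ)^2) :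
    ({z : ℝ × ℝ | ham z = α} ∩ Delta).Finite ∧
    ({z : ℝ × ℝ | ham z = α} ∩ Delta).ncard = 4 * (2 * (⌊Real.sqrt α⌋).toNat + 1) := by
  have hham : ∀ z : ℝ × ℝ, ham z.swap = ham z := fun z => by simp [ham, add_comm]
  have hmem2 : ∀ z, z ∈ (vset α).image Prod.swap ↔ ham z = α ∧ ∃ m : ℤ, z.2 = m := by
    intro z
    rw [Finset.mem_image]
    constructor
    · rintro ⟨w, hw, rfl⟩
      rw [mem_vset α hα h] at hw
      rw [hham]; exact hw
    · intro hz
      refine ⟨z.swap, ?_, Prod.swap_swap z⟩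
      rw [mem_vset α hα h, hham]; exact hz
  have hfl : ∀ x : ℝ, x - ⌊x⌋ = 0 ↔ ∃ m : ℤ, x = m := by
    intro x
    constructor
    · intro hx; exact ⟨⌊x⌋, by linarith⟩
    · rintro ⟨m, rfl⟩; simp
  have hS : {z : ℝ × ℝ | ham z = α} ∩ Delta
      = ((vset α ∪ (vset α).image Prod.swap : Finset (ℝ × ℝ)) : Set (ℝ × ℝ)) := by
    ext z
    rw [Finset.mem_coe, Finset.mem_union, hmem2, mem_vset α hα h, ← and_or_left,
      ← hfl, ← hfl, ← mul_eq_zero]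
    rfl
  rw [hS]
  refine ⟨Finset.finite_toSet _, ?_⟩
  rw [Set.ncard_coe_finset, Finset.card_union_of_disjoint,
    Finset.card_image_of_injective _ Prod.swap_injective, card_vset α hα h]
  · ring
  · rw [Finset.disjoint_left]
    intro z hz hz'
    rw [mem_vset α hα h] at hz
    rw [hmem2] at hz'
    obtain ⟨hz, m, hm⟩ := hz
    obtain ⟨-, n, hn⟩ := hz'
    refine h ⟨m, n, ?_⟩
    rw [← hz, ham, hm, hn, Pfun_int, Pfun_int]
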